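/- For all natural numbers n and k with 0 ≤ k ≤ n, the following identity of polynomials in q holds: (1-q)^{n-k} · Σ_{π ∈ Π_n, |π|=k} q^{cro*(π)} = Σ_{j=0}^{n-k} (-1)^j · C(n, k+j) · [k+j choose j]_q, where C(·,·) is the binomial coefficient and [k+j choose j]_q is the Gaussian (q-)binomial coefficient. -/

import Mathlib

open Finset

inductive Step : Type
  | U | L | D
deriving DecidableEq

instance : Fintype Step := ⟨⟨([.U, .L, .D] : List Step), by decide⟩, by intro x; cases x <;> decide⟩

/-- The vertical displacement of a step: up = +1, level = 0, down = -1. -/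
def Step.val : Step → ℤ
  | .U => 1
  | .L => 0
  | .D => -1

/-- The partial sum of the step values of the first `i` steps;
this is the height at which step `i` starts. -/
def hsum {n : ℕ} (P : Fin n → Step) (i : ℕ) : ℤ :=
  ∑ j ∈ Finset.univ.filter (fun j : Fin n => (j : ℕ) < i), (P j).val

/-- A Motzkin path: all partial sums nonnegative and total sum 0. -/
abbrev IsMotzkin {n : ℕ} (P : Fin n → Step) : Prop :=
  (∀ i : Fin (n+1), 0 ≤ hsum P (i : ℕ)) ∧ hsum P n = 0

/-- A Motzkin prefix of final height `k`: all partial sums nonnegative, total sum `k`. -/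
abbrev IsMPrefix {n : ℕ} (P : Fin n → Step) (k : ℕ) : Prop :=
  (∀ i : Fin (n+1), 0 ≤ hsum P (i : ℕ)) ∧ hsum P n = (k : ℤ)

/-- `[h]_q = 1 + q + ... + q^(h-1)`. -/
def geo {R : Type*} [CommSemiring R] (q : R) (h : ℤ) : R :=
  ∑ i ∈ Finset.range h.toNat, q ^ i

/-- The Gaussian (q-)binomial coefficient, via the q-Pascal recurrence. -/
def qbinom {R : Type*} [CommSemiring R] (q : R) : ℕ → ℕ → R
  | _, 0 => 1
  | 0, _+1 => 0
  | n+1, k+1 => qbinom q n k + q ^ (k+1) * qbinom q n (k+1)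

/-- The binomial coefficient with integer lower argument, zero on negative arguments. -/
def ch (m : ℕ) (j : ℤ) : ℤ := if 0 ≤ j then m.choose j.toNat else 0

/-- A set partition of `Fin n`, given as the finset of its blocks:
blocks are nonempty and every element lies in exactly one block. -/
abbrev IsPartition {n : ℕ} (P : Finset (Finset (Fin n))) : Prop :=
  (∀ B ∈ P, B.Nonempty) ∧ ∀ x : Fin n, (P.filter (fun B => x ∈ B)).card = 1

/-- `(a, b)` is an arc of the partition `P`: `a < b`, they lie in a common block,
and no element of that block is strictly between them. -/
abbrev IsArc {n : ℕ} (P : Finset (Finset (Fin n))) (a b : Fin n) : Prop :=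
  a < b ∧ ∃ B ∈ P, a ∈ B ∧ b ∈ B ∧ ∀ c ∈ B, ¬(a < c ∧ c < b)

/-- The number of crossings of a set partition: pairs of arcs `(i,j)`, `(k,l)`
with `i < k < j < l`. -/
def croP {n : ℕ} (P : Finset (Finset (Fin n))) : ℕ :=
  (Finset.univ.filter (fun x : (Fin n × Fin n) × (Fin n × Fin n) =>
    IsArc P x.1.1 x.1.2 ∧ IsArc P x.2.1 x.2.2 ∧
    x.1.1 < x.2.1 ∧ x.2.1 < x.1.2 ∧ x.1.2 < x.2.2)).card

/-- The modified crossing number `cro*`: crossings, plus pairs of a block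
maximum `m` and an arc `(k,l)` with `k < m < l`. -/
def croStar {n : ℕ} (P : Finset (Finset (Fin n))) : ℕ :=
  croP P +
  (Finset.univ.filter (fun x : Fin n × Fin n × Fin n =>
    (∃ B ∈ P, x.1 ∈ B ∧ ∀ y ∈ B, y ≤ x.1) ∧
    IsArc P x.2.1 x.2.2 ∧ x.2.1 < x.1 ∧ x.1 < x.2.2)).card


section alg
open Polynomial

lemma qb_zero (q : ℤ[X]) (n : ℕ) : qbinom q n 0 = 1 := by cases n <;> rfl

lemma qb_gt (q : ℤ[X]) (n : ℕ) : ∀ k, n < k → qbinom q n k = 0 := by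
  induction n with
  | zero => intro k hk; cases k with
    | zero => omega
    | succ k => rfl
  | succ n ih => intro k hk; cases k with
    | zero => omega
    | succ k => rw [qbinom, ih k (by omega), ih (k+1) (by omega)]; simp

lemma qb_self (q : ℤ[X]) (n : ℕ) : qbinom q n n = 1 := by
  induction n with
  | zero => rfl
  | succ n ih => rw [qbinom, ih, qb_gt q n (n+1) (by omega)]; simp

lemma qb_pascal (q : ℤ[X]) (s : ℕ) : ∀ k j, k + j = s →
    qbinom q (k+1+(j+1)) (j+1) = qbinom q (k+(j+1)) (j+1) + q^(k+1) * qbinom q (k+1+j) j := by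
  induction s with
  | zero =>
    intro k j h
    obtain ⟨rfl, rfl⟩ : k = 0 ∧ j = 0 := by omega
    simp [qbinom]
  | succ s ih =>
    intro k j h
    have e : qbinom q (k+1+(j+1)) (j+1) = qbinom q (k+1+j) j + q^(j+1) * qbinom q (k+(j+1)) (j+1) := by
      rw [show k+1+(j+1) = (k+1+j)+1 by ring, qbinom, show k+1+j = k+(j+1) by ring]
    rw [e]
    rcases k with _ | k
    · rcases j with _ | j
      · omega
      · have h1 := ih 0 j (by omega)
        have e1 : qbinom q (0+1+(j+1)) (j+1) = qbinom q (0+1+j) j + q^(j+1) * qbinom q (0+(j+1)) (j+1) := by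
          rw [show 0+1+(j+1) = (0+1+j)+1 by ring, qbinom, show 0+1+j = 0+(j+1) by ring]
        simp only [zero_add, qb_self] at h1 e1 ⊢
        linear_combination h1 - q * e1
    · rcases j with _ | j
      · have h1 := ih k 0 (by omega)
        simp only [zero_add, qb_zero, add_zero] at h1 ⊢
        have e1 : qbinom q (k+1+1) 1 = 1 + q * qbinom q (k+1) 1 := by
          rw [qbinom, qb_zero]; simp
        linear_combination q * h1 - e1
      · have h1 := ih (k+1) j (by omega)
        have h2 := ih k (j+1) (by omega)
        have e1 : qbinom q (k+1+(j+1+1)) (j+1+1) = qbinom q (k+1+(j+1)) (j+1) + q^(j+1+1) * qbinom q (k+(j+1+1)) (j+1+1) := by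
          rw [show k+1+(j+1+1) = (k+1+(j+1))+1 by ring, qbinom, show k+1+(j+1) = k+(j+1+1) by ring]
        have e2 : qbinom q (k+1+1+(j+1)) (j+1) = qbinom q (k+1+1+j) j + q^(j+1) * qbinom q (k+1+(j+1)) (j+1) := by
          rw [show k+1+1+(j+1) = (k+1+1+j)+1 by ring, qbinom, show k+1+1+j = k+1+(j+1) by ring]
        linear_combination h1 + q^(j+2) * h2 - e1 - q^(k+2)*e2

noncomputable def qS : ℕ → ℕ → ℤ[X]
  | 0, 0 => 1
  | 0, _+1 => 0
  | _+1, 0 => 0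
  | n+1, k+1 => qS n k + (∑ i ∈ range (k+1), X^i) * qS n (k+1)

noncomputable def GG (N n k : ℕ) : ℤ[X] :=
  ∑ j ∈ range N, (-1)^j * (n.choose (k+j) : ℤ[X]) * qbinom X (k+j) j

lemma GG_eq (N n k : ℕ) (h : n < k + N) (M : ℕ) (hM : N ≤ M) : GG M n k = GG N n k := by
  unfold GG
  symm
  apply sum_subset
  · intro x; simp; omega
  · intro x _ hx
    simp at hx
    rw [Nat.choose_eq_zero_of_lt (by omega)]; simp

lemma GG_rec (N n k : ℕ) (h : n < k + 1 + N) :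
    GG (N+1) (n+1) (k+1) = GG (N+1) n k + (1 - X^(k+1)) * GG N n (k+1) := by
  have h1 : GG (N+1) (n+1) (k+1) = (∑ j ∈ range (N+1), (-1)^j * (n.choose (k+j) : ℤ[X]) * qbinom X (k+1+j) j) + GG (N+1) n (k+1) := by
    unfold GG
    rw [← sum_add_distrib]
    apply sum_congr rfl
    intro j _
    rw [show k+1+j = (k+j)+1 by ring, Nat.choose_succ_succ]
    push_cast; ring
  have h2 : (∑ j ∈ range (N+1), (-1)^j * (n.choose (k+j) : ℤ[X]) * qbinom X (k+1+j) j) = GG (N+1) n k - X^(k+1) * GG N n (k+1) := by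
    unfold GG
    rw [sum_range_succ', sum_range_succ' (n := N), mul_sum, qb_zero, qb_zero]
    rw [add_sub_right_comm, ← sum_sub_distrib]
    congr 1
    apply sum_congr rfl
    intro j _
    rw [qb_pascal X _ k j rfl, show k+1+j = k+(j+1) by ring]
    ring
  rw [h1, h2, GG_eq N n (k+1) (by omega) (N+1) (by omega)]
  ring

lemma carlitz (n : ℕ) : ∀ k, (1 - X)^n * qS n k = (1 - X)^k * GG (n+1) n k := by
  induction n with
  | zero =>
    intro k; cases k with
    | zero => simp [qS, GG, qbinom]
    | succ k => simp [qS, GG]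
  | succ n ih =>
    intro k; cases k with
    | zero =>
      have := Int.alternating_sum_range_choose (n := n+1)
      have h2 := congrArg (Int.cast : ℤ → ℤ[X]) this
      simp at h2
      simp [qS, GG, qb_self, h2]
    | succ k =>
      have h1 := ih k
      have h2 := ih (k+1)
      have g : (1 - X) * (∑ i ∈ range (k+1), (X:ℤ[X])^i) = 1 - X^(k+1) := by
        exact mul_neg_geom_sum X (k+1)
      rw [GG_rec _ _ _ (by omega), GG_eq (n+1) n k (by omega) (n+1+1) (by omega), qS]
      linear_combination (1 - X) * h1 + (1-X^(k+1)) * h2 + (1-X)^n * qS n (k+1) * g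

lemma carlitz' (n k : ℕ) (hk : k ≤ n) : (1 - X)^(n-k) * qS n k = ∑ j ∈ Finset.range (n-k+1),
        (-1 : Polynomial ℤ) ^ j * ((ch n ((k : ℤ) + j) : ℤ) : Polynomial ℤ) *
          qbinom (X : Polynomial ℤ) (k+j) j := by
  have h := carlitz n k
  have h0 : (1 - X : ℤ[X]) ≠ 0 := by
    intro h
    have := congrArg (eval 0) h
    simp at this
  have e : (1 - X : ℤ[X])^n = (1-X)^k * (1-X)^(n-k) := by rw [← pow_add]; congr 1; omega
  rw [e, mul_assoc] at h
  rw [mul_left_cancel₀ (pow_ne_zero k h0) h, GG_eq (n-k+1) n k (by omega) _ (by omega)]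
  unfold GG
  apply sum_congr rfl
  intro j _
  congr 2
end alg

section comb

def IsMx {n : ℕ} (P : Finset (Finset (Fin n))) (x : Fin n) : Prop :=
  ∃ B ∈ P, x ∈ B ∧ ∀ y ∈ B, y ≤ x

lemma part_iff {n : ℕ} (P : Finset (Finset (Fin n))) :
    IsPartition P ↔ (∀ B ∈ P, B.Nonempty) ∧ (∀ x, ∃ B ∈ P, x ∈ B) ∧
      ∀ x, ∀ B ∈ P, ∀ C ∈ P, x ∈ B → x ∈ C → B = C := by
  unfold IsPartition
  constructor
  · rintro ⟨h1, h2⟩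
    refine ⟨h1, ?_, ?_⟩
    · intro x
      obtain ⟨B, hB⟩ := card_eq_one.1 (h2 x)
      have : B ∈ P.filter (fun B => x ∈ B) := by rw [hB]; simp
      simp at this
      exact ⟨B, this⟩
    · intro x B hB C hC hxB hxC
      have := card_le_one.1 (h2 x).le B (by simp [hB, hxB]) C (by simp [hC, hxC])
      exact this
  · rintro ⟨h1, h2, h3⟩
    refine ⟨h1, ?_⟩
    intro x
    obtain ⟨B, hB, hx⟩ := h2 x
    rw [card_eq_one]
    refine ⟨B, ?_⟩
    ext C
    simp only [mem_filter, mem_singleton]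
    constructor
    · rintro ⟨hC, hxC⟩
      exact h3 x C hC B hB hxC hx
    · rintro rfl
      exact ⟨hB, hx⟩

def lft {n : ℕ} (B : Finset (Fin n)) : Finset (Fin (n+1)) := B.map Fin.castSuccEmb

def pre {n : ℕ} (C : Finset (Fin (n+1))) : Finset (Fin n) := univ.filter (fun x => x.castSucc ∈ C)

@[simp] lemma cs_mem_lft {n : ℕ} (B : Finset (Fin n)) (x : Fin n) : x.castSucc ∈ lft B ↔ x ∈ B := by
  simp [lft]

@[simp] lemma last_mem_lft {n : ℕ} (B : Finset (Fin n)) : Fin.last n ∉ lft B := by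
  simp [lft, Fin.castSucc_ne_last]

@[simp] lemma mem_pre {n : ℕ} (C : Finset (Fin (n+1))) (x : Fin n) : x ∈ pre C ↔ x.castSucc ∈ C := by
  simp [pre]

@[simp] lemma pre_lft {n : ℕ} (B : Finset (Fin n)) : pre (lft B) = B := by ext; simp

@[simp] lemma pre_ins {n : ℕ} (B : Finset (Fin n)) : pre (insert (Fin.last n) (lft B)) = B := by
  ext; simp [Fin.castSucc_ne_last]

lemma lft_inj {n : ℕ} : Function.Injective (lft (n := n)) := fun B C h => by
  rw [← pre_lft B, h, pre_lft]

lemma lft_pre {n : ℕ} (C : Finset (Fin (n+1))) (h : Fin.last n ∉ C) : lft (pre C) = C := by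
  ext x; induction x using Fin.lastCases <;> simp [h]

lemma ins_pre {n : ℕ} (C : Finset (Fin (n+1))) (h : Fin.last n ∈ C) :
    insert (Fin.last n) (lft (pre C)) = C := by
  ext x; induction x using Fin.lastCases <;> simp [h, Fin.castSucc_ne_last]

/-- adds the last point to block `B` (a new block when `B = ∅`) -/
def ext1 {n : ℕ} (P : Finset (Finset (Fin n))) (B : Finset (Fin n)) : Finset (Finset (Fin (n+1))) :=
  insert (insert (Fin.last n) (lft B)) ((P.erase B).image lft)

def rst {n : ℕ} (Q : Finset (Finset (Fin (n+1)))) : Finset (Finset (Fin n)) :=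
  (Q.image pre).erase ∅

lemma mem_ext1 {n : ℕ} (P : Finset (Finset (Fin n))) (B : Finset (Fin n)) (C) :
    C ∈ ext1 P B ↔ C = insert (Fin.last n) (lft B) ∨ ∃ D ∈ P, D ≠ B ∧ C = lft D := by
  simp only [ext1, mem_insert, mem_image, mem_erase]
  constructor
  · rintro (h | ⟨D, ⟨h1, h2⟩, rfl⟩)
    · exact Or.inl h
    · exact Or.inr ⟨D, h2, h1, rfl⟩
  · rintro (h | ⟨D, h1, h2, rfl⟩)
    · exact Or.inl h
    · exact Or.inr ⟨D, ⟨h2, h1⟩, rfl⟩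

lemma card_ext1 {n : ℕ} (P : Finset (Finset (Fin n))) (B : Finset (Fin n)) :
    (ext1 P B).card = (P.erase B).card + 1 := by
  rw [ext1, card_insert_of_notMem, card_image_of_injective _ lft_inj]
  simp only [mem_image, not_exists, not_and]
  intro D _ h
  apply last_mem_lft D
  rw [h]; simp

lemma part_ext1 {n : ℕ} (P : Finset (Finset (Fin n))) (B : Finset (Fin n)) (hP : IsPartition P)
    (hB : B ∈ P ∨ B = ∅) : IsPartition (ext1 P B) := by
  rw [part_iff] at hP ⊢
  obtain ⟨h1, h2, h3⟩ := hP
  have key : ∀ x, x ∈ B → ∀ D ∈ P, x ∈ D → D = B := by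
    intro x hx D hD hxD
    rcases hB with hB | rfl
    · exact h3 x D hD B hB hxD hx
    · simp at hx
  refine ⟨?_, ?_, ?_⟩
  · intro C hC
    rw [mem_ext1] at hC
    rcases hC with rfl | ⟨D, hD, -, rfl⟩
    · simp
    · obtain ⟨x, hx⟩ := h1 D hD
      exact ⟨x.castSucc, by simpa⟩
  · intro x
    induction x using Fin.lastCases with
    | last => exact ⟨_, (mem_ext1 _ _ _).2 (Or.inl rfl), by simp⟩
    | cast x =>
      obtain ⟨D, hD, hx⟩ := h2 x
      by_cases e : D = B
      · exact ⟨_, (mem_ext1 _ _ _).2 (Or.inl rfl), by simp [← e, hx]⟩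
      · exact ⟨_, (mem_ext1 _ _ _).2 (Or.inr ⟨D, hD, e, rfl⟩), by simpa⟩
  · intro x C hC D hD hxC hxD
    rw [mem_ext1] at hC hD
    induction x using Fin.lastCases with
    | last =>
      rcases hC with rfl | ⟨C, hC, hCB, rfl⟩
      · rcases hD with rfl | ⟨D, hD, hDB, rfl⟩
        · rfl
        · simp at hxD
      · simp at hxC
    | cast x =>
      rcases hC with rfl | ⟨C, hC, hCB, rfl⟩
      · rcases hD with rfl | ⟨D, hD, hDB, rfl⟩
        · rfl
        · simp [Fin.castSucc_ne_last] at hxC hxD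
          exact (hDB (key x hxC D hD hxD)).elim
      · rcases hD with rfl | ⟨D, hD, hDB, rfl⟩
        · simp [Fin.castSucc_ne_last] at hxC hxD
          exact (hCB (key x hxD C hC hxC)).elim
        · simp at hxC hxD
          rw [h3 x C hC D hD hxC hxD]

lemma rst_ext1 {n : ℕ} (P : Finset (Finset (Fin n))) (B : Finset (Fin n)) (hP : IsPartition P)
    (hB : B ∈ P ∨ B = ∅) : rst (ext1 P B) = P := by
  have h0 : ∅ ∉ P := fun h => by simpa using hP.1 _ h
  ext D
  simp only [rst, mem_erase, mem_image, mem_ext1]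
  constructor
  · rintro ⟨hD, C, (rfl | ⟨E, hE, hEB, rfl⟩), rfl⟩
    · simp at hD ⊢
      tauto
    · simpa
  · intro hD
    refine ⟨fun e => h0 (e ▸ hD), ?_⟩
    by_cases e : D = B
    · exact ⟨_, Or.inl rfl, by simp [e]⟩
    · exact ⟨_, Or.inr ⟨D, hD, e, rfl⟩, by simp⟩

lemma ext1_inj {n : ℕ} (P P' : Finset (Finset (Fin n))) (B B' : Finset (Fin n)) (hP : IsPartition P)
    (hP' : IsPartition P')
    (hB : B ∈ P ∨ B = ∅) (hB' : B' ∈ P' ∨ B' = ∅) (h : ext1 P B = ext1 P' B') : P = P' ∧ B = B' := by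
  refine ⟨by rw [← rst_ext1 P B hP hB, h, rst_ext1 P' B' hP' hB'], ?_⟩
  have h1 : insert (Fin.last n) (lft B) ∈ ext1 P' B' := by rw [← h, mem_ext1]; exact Or.inl rfl
  rw [mem_ext1] at h1
  rcases h1 with h1 | ⟨D, _, _, h1⟩
  · rw [← pre_ins B, h1, pre_ins]
  · exact (last_mem_lft D (h1 ▸ by simp)).elim

lemma ext1_surj {n : ℕ} (Q : Finset (Finset (Fin (n+1)))) (hQ : IsPartition Q) :
    ∃ P B, IsPartition P ∧ (B ∈ P ∨ B = ∅) ∧ ext1 P B = Q := by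
  rw [part_iff] at hQ
  obtain ⟨h1, h2, h3⟩ := hQ
  obtain ⟨C, hC, hl⟩ := h2 (Fin.last n)
  have hne : ∀ D ∈ Q, D ≠ C → Fin.last n ∉ D := fun D hD hDC h => hDC (h3 _ D hD C hC h hl)
  have pinj : ∀ D ∈ Q, ∀ E ∈ Q, ∀ x, x ∈ pre D → x ∈ pre E → D = E := by
    intro D hD E hE x hx hy
    simp at hx hy
    exact h3 _ D hD E hE hx hy
  refine ⟨rst Q, pre C, ?_, ?_, ?_⟩
  · rw [part_iff]
    refine ⟨?_, ?_, ?_⟩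
    · intro B hB
      simp only [rst, mem_erase] at hB
      exact nonempty_iff_ne_empty.2 hB.1
    · intro x
      obtain ⟨D, hD, hx⟩ := h2 x.castSucc
      refine ⟨pre D, ?_, by simpa⟩
      simp only [rst, mem_erase, mem_image]
      refine ⟨?_, D, hD, rfl⟩
      rw [← nonempty_iff_ne_empty]
      exact ⟨x, by simpa⟩
    · intro x B hB B' hB' hx hx'
      simp only [rst, mem_erase, mem_image] at hB hB'
      obtain ⟨_, D, hD, rfl⟩ := hB
      obtain ⟨_, D', hD', rfl⟩ := hB'
      rw [pinj D hD D' hD' x hx hx']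
  · by_cases e : pre C = ∅
    · exact Or.inr e
    · left
      simp only [rst, mem_erase, mem_image]
      exact ⟨e, C, hC, rfl⟩
  · ext D
    rw [mem_ext1, ins_pre C hl]
    constructor
    · rintro (rfl | ⟨E, hE, hEC, rfl⟩)
      · exact hC
      · simp only [rst, mem_erase, mem_image] at hE
        obtain ⟨_, F, hF, rfl⟩ := hE
        rw [lft_pre F]
        · exact hF
        · apply hne F hF
          rintro rfl
          exact hEC rfl
    · intro hD
      by_cases e : D = C
      · exact Or.inl e
      · right
        have hp := lft_pre D (hne D hD e)
        obtain ⟨y, hy⟩ := h1 D hD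
        have hy' : ∃ x, x ∈ pre D := by
          induction y using Fin.lastCases with
          | last => exact (hne D hD e hy).elim
          | cast x => exact ⟨x, by simpa⟩
        obtain ⟨x, hx⟩ := hy'
        refine ⟨pre D, ?_, ?_, hp.symm⟩
        · simp only [rst, mem_erase, mem_image]
          exact ⟨nonempty_iff_ne_empty.1 ⟨x, hx⟩, D, hD, rfl⟩
        · intro h
          exact e (pinj D hD C hC x hx (h ▸ hx))

/-! arcs and maxima -/

lemma arc_cs {n : ℕ} (P : Finset (Finset (Fin n))) (B : Finset (Fin n))
    (hB : B ∈ P ∨ B = ∅) (a b : Fin n) : IsArc (ext1 P B) a.castSucc b.castSucc ↔ IsArc P a b := by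
  unfold IsArc
  simp only [Fin.castSucc_lt_castSucc_iff, mem_ext1]
  refine and_congr_right fun hab => ?_
  constructor
  · rintro ⟨C, (rfl | ⟨D, hD, hDB, rfl⟩), ha, hb, h⟩
    · simp [Fin.castSucc_ne_last] at ha hb
      rcases hB with hB | rfl
      · refine ⟨B, hB, ha, hb, fun c hc => ?_⟩
        have := h c.castSucc (by simp [hc])
        simpa using this
      · simp at ha
    · refine ⟨D, hD, by simpa using ha, by simpa using hb, fun c hc => ?_⟩
      have := h c.castSucc (by simp [hc])
      simpa using this
  · rintro ⟨D, hD, ha, hb, h⟩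
    by_cases e : D = B
    · subst e
      refine ⟨_, Or.inl rfl, by simp [ha], by simp [hb], ?_⟩
      intro c hc
      induction c using Fin.lastCases with
      | last => exact fun h => absurd h.2 (not_lt.2 (Fin.le_last _))
      | cast c =>
        simp [Fin.castSucc_ne_last] at hc
        simpa using h c hc
    · refine ⟨_, Or.inr ⟨D, hD, e, rfl⟩, by simp [ha], by simp [hb], ?_⟩
      intro c hc
      induction c using Fin.lastCases with
      | last => simp at hc
      | cast c =>
        simp at hc
        simpa using h c hc

lemma arc_last {n : ℕ} (P : Finset (Finset (Fin n))) (B) (b) : ¬ IsArc (ext1 P B) (Fin.last n) b := by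
  rintro ⟨h, _⟩
  exact absurd h (not_lt.2 (Fin.le_last _))

lemma arc_cs_last {n : ℕ} (P : Finset (Finset (Fin n))) (B : Finset (Fin n)) (a : Fin n) :
    IsArc (ext1 P B) a.castSucc (Fin.last n) ↔ a ∈ B ∧ ∀ y ∈ B, y ≤ a := by
  unfold IsArc
  simp only [mem_ext1]
  constructor
  · rintro ⟨hab, C, (rfl | ⟨D, hD, hDB, rfl⟩), ha, hb, h⟩
    · simp [Fin.castSucc_ne_last] at ha
      refine ⟨ha, fun y hy => ?_⟩
      have := h y.castSucc (by simp [hy])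
      simpa [Fin.castSucc_lt_last] using this
    · simp at hb
  · rintro ⟨ha, h⟩
    refine ⟨Fin.castSucc_lt_last a, _, Or.inl rfl, by simp [ha], by simp, ?_⟩
    intro c hc
    induction c using Fin.lastCases with
    | last => simp
    | cast c =>
      simp [Fin.castSucc_ne_last] at hc
      simpa [Fin.castSucc_lt_last] using h c hc

lemma mx_last {n : ℕ} (P : Finset (Finset (Fin n))) (B : Finset (Fin n)) :
    IsMx (ext1 P B) (Fin.last n) :=
  ⟨_, (mem_ext1 _ _ _).2 (Or.inl rfl), by simp, fun y _ => Fin.le_last y⟩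

lemma mx_cs {n : ℕ} (P : Finset (Finset (Fin n))) (B : Finset (Fin n)) (hP : IsPartition P)
    (hB : B ∈ P ∨ B = ∅) (x : Fin n) :
    IsMx (ext1 P B) x.castSucc ↔ IsMx P x ∧ x ∉ B := by
  rw [part_iff] at hP
  unfold IsMx
  simp only [mem_ext1]
  constructor
  · rintro ⟨C, (rfl | ⟨D, hD, hDB, rfl⟩), ha, h⟩
    · have := h (Fin.last n) (by simp)
      exact absurd this (not_le.2 (Fin.castSucc_lt_last x))
    · simp at ha
      refine ⟨⟨D, hD, ha, fun y hy => ?_⟩, fun hx => ?_⟩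
      · simpa using h y.castSucc (by simp [hy])
      · rcases hB with hB | rfl
        · exact hDB (hP.2.2 x D hD B hB ha hx)
        · simp at hx
  · rintro ⟨⟨D, hD, ha, h⟩, hx⟩
    refine ⟨_, Or.inr ⟨D, hD, fun e => hx (e ▸ ha), rfl⟩, by simp [ha], ?_⟩
    intro c hc
    induction c using Fin.lastCases with
    | last => simp at hc
    | cast c =>
      simp at hc
      simpa using h c hc

open Classical in
noncomputable def ind (p : Prop) : ℕ := if p then 1 else 0
lemma ind_t {p : Prop} (h : p) : ind p = 1 := by simp [ind, h]
lemma ind_f {p : Prop} (h : ¬ p) : ind p = 0 := by simp [ind, h]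
lemma ind_and (p r : Prop) : ind (p ∧ r) = ind p * ind r := by
  by_cases h : p <;> by_cases h' : r <;> simp [ind, h, h']
lemma ind_ite (p : Prop) [Decidable p] : (if p then 1 else 0) = ind p := by
  by_cases h : p <;> simp [ind, h]
noncomputable def ia {n : ℕ} (P : Finset (Finset (Fin n))) (i j : Fin n) : ℕ := ind (IsArc P i j)
noncomputable def im {n : ℕ} (P : Finset (Finset (Fin n))) (i : Fin n) : ℕ := ind (IsMx P i)
noncomputable def il {n : ℕ} (i j : Fin n) : ℕ := ind (i < j)

lemma croStar_eq {n : ℕ} (P : Finset (Finset (Fin n))) : croStar P =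
    (∑ i, ∑ j, ∑ k, ∑ l, ia P i j * ia P k l * (il i k * il k j * il j l)) +
    ∑ x, ∑ k, ∑ l, im P x * ia P k l * (il k x * il x l) := by
  unfold croStar croP
  simp only [card_filter, Fintype.sum_prod_type, ind_ite]
  congr 1
  · refine sum_congr rfl fun i _ => sum_congr rfl fun j _ => sum_congr rfl fun k _ => sum_congr rfl fun l _ => ?_
    simp only [ia, il, IsArc, ind_and]
    ring
  · refine sum_congr rfl fun x _ => sum_congr rfl fun k _ => sum_congr rfl fun l _ => ?_
    change ind (IsMx P x ∧ _) = _
    simp only [ia, il, im, IsArc, ind_and]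
    ring

lemma il_cs {n : ℕ} (i j : Fin n) : il i.castSucc j.castSucc = il i j := by simp [il, Fin.castSucc_lt_castSucc_iff]
lemma il_cl {n : ℕ} (i : Fin n) : il i.castSucc (Fin.last n) = 1 := ind_t (Fin.castSucc_lt_last i)
lemma il_l {n : ℕ} (i : Fin (n+1)) : il (Fin.last n) i = 0 := by
  exact ind_f (not_lt.2 (Fin.le_last _))
lemma ia_l {n : ℕ} (P : Finset (Finset (Fin n))) (B b) : ia (ext1 P B) (Fin.last n) b = 0 := by
  exact ind_f (arc_last _ _ _)
lemma ia_cs {n : ℕ} (P : Finset (Finset (Fin n))) (B) (hB : B ∈ P ∨ B = ∅) (a b) :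
    ia (ext1 P B) (Fin.castSucc a) (Fin.castSucc b) = ia P a b := by
  simp only [ia, arc_cs P B hB]
lemma im_l {n : ℕ} (P : Finset (Finset (Fin n))) (B) : im (ext1 P B) (Fin.last n) = 1 := by
  exact ind_t (mx_last _ _)

lemma croStar_empty {n : ℕ} (P : Finset (Finset (Fin n))) (hP : IsPartition P) :
    croStar (ext1 P ∅) = croStar P := by
  have h1 : ∀ a : Fin n, ia (ext1 P ∅) a.castSucc (Fin.last n) = 0 := by
    intro a; simp only [ia, arc_cs_last]; exact ind_f (by simp)
  have h2 : ∀ a : Fin n, im (ext1 P ∅) a.castSucc = im P a := by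
    intro a; simp only [im, mx_cs P ∅ hP (Or.inr rfl)]; simp
  rw [croStar_eq, croStar_eq]
  simp only [Fin.sum_univ_castSucc, il_cs, il_cl, il_l, ia_l, ia_cs P ∅ (Or.inr rfl), im_l, h1, h2,
    mul_zero, zero_mul, sum_const_zero, add_zero]

lemma croStar_block {n : ℕ} (P : Finset (Finset (Fin n))) (hP : IsPartition P) (B) (hB : B ∈ P)
    (m : Fin n) (hm : m ∈ B) (hm' : ∀ y ∈ B, y ≤ m) :
    croStar (ext1 P B) = croStar P + ∑ x, im P x * il m x := by
  have hM : ∀ a : Fin n, (a ∈ B ∧ ∀ y ∈ B, y ≤ a) ↔ a = m := by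
    intro a
    constructor
    · rintro ⟨h1, h2⟩; exact le_antisymm (hm' a h1) (h2 m hm)
    · rintro rfl; exact ⟨hm, hm'⟩
  have h1 : ∀ a : Fin n, ia (ext1 P B) a.castSucc (Fin.last n) = if a = m then 1 else 0 := by
    intro a; simp only [ia, arc_cs_last, hM, ind]
  have h2 : ∀ a : Fin n, im P a = im (ext1 P B) a.castSucc + if a = m then 1 else 0 := by
    intro a; simp only [im, mx_cs P B hP (Or.inl hB)]
    by_cases e : a = m
    · subst e
      have : IsMx P a := ⟨B, hB, hm, hm'⟩
      simp [hm, this, ind]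
    · by_cases hx : IsMx P a
      · have : a ∉ B := by
          intro ha
          obtain ⟨C, hC, haC, hmx⟩ := hx
          have := ((part_iff P).1 hP).2.2 a C hC B hB haC ha
          subst this
          exact e ((hM a).1 ⟨ha, hmx⟩)
        simp [hx, this, e, ind]
      · simp [hx, e, ind]
  rw [croStar_eq, croStar_eq]
  simp only [h2]
  simp only [Fin.sum_univ_castSucc, il_cs, il_cl, il_l, ia_l, ia_cs P B (Or.inl hB), im_l, h1,
    mul_zero, zero_mul, sum_const_zero, add_zero, mul_one, add_mul, sum_add_distrib, one_mul,
    ite_mul, mul_ite, sum_ite_eq', mem_univ, if_true]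
  have : il m m = 0 := ind_f (lt_irrefl _)
  rw [this]
  have hs : (∑ x, ∑ y, ∑ z, if x = m then ia P y z * (il y x * il x z) else 0) =
      ∑ y, ∑ z, ia P y z * (il y m * il m z) := by
    rw [sum_eq_single m]
    · simp
    · intro b _ hb
      simp [hb]
    · simp
  rw [hs]
  ring

open Polynomial

lemma sum_desc {α : Type*} [LinearOrder α] (M : Finset α) :
    ∑ m ∈ M, (X : ℤ[X]) ^ (M.filter (fun x => m < x)).card = ∑ i ∈ range M.card, X ^ i := by
  induction M using Finset.induction_on_max with
  | empty => simp
  | insert a s h ih =>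
    have ha : a ∉ s := fun h' => lt_irrefl _ (h a h')
    rw [sum_insert ha, card_insert_of_notMem ha, sum_range_succ', add_comm]
    congr 1
    · simp only [pow_succ]
      rw [← sum_mul, ← ih, sum_mul]
      apply sum_congr rfl
      intro m hm
      rw [← pow_succ, filter_insert, if_pos (h m hm), card_insert_of_notMem (by simp [ha])]
    · congr 1
      rw [card_eq_zero, filter_eq_empty_iff]
      intro x hx
      rcases mem_insert.1 hx with rfl | hx
      · simp
      · exact not_lt.2 (h x hx).le

lemma sum_block {n : ℕ} (P : Finset (Finset (Fin n))) (hP : IsPartition P) :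
    ∑ B ∈ P, (X : ℤ[X]) ^ croStar (ext1 P B) = (∑ i ∈ range P.card, X ^ i) * X ^ croStar P := by
  classical
  set M := univ.filter (fun x => IsMx P x) with hM
  obtain ⟨h1, h2, h3⟩ := (part_iff P).1 hP
  have hinj : ∀ B (hB : B ∈ P) C (hC : C ∈ P), B.max' (h1 B hB) = C.max' (h1 C hC) → B = C := by
    intro B hB C hC h
    exact h3 _ B hB C hC (max'_mem B (h1 B hB)) (h ▸ max'_mem C (h1 C hC))
  have hmem : ∀ B (hB : B ∈ P), B.max' (h1 B hB) ∈ M := by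
    intro B hB
    rw [hM, mem_filter]
    exact ⟨mem_univ _, B, hB, max'_mem _ _, fun y hy => le_max' _ _ hy⟩
  have hsurj : ∀ m ∈ M, ∃ B, ∃ hB : B ∈ P, B.max' (h1 B hB) = m := by
    intro m hm
    rw [hM, mem_filter] at hm
    obtain ⟨-, B, hB, hmB, hmx⟩ := hm
    exact ⟨B, hB, le_antisymm (max'_le _ _ _ hmx) (le_max' _ _ hmB)⟩
  have hcard : P.card = M.card :=
    card_bij (fun B hB => B.max' (h1 B hB)) hmem (fun B hB C hC => hinj B hB C hC) hsurj
  rw [hcard, ← sum_desc, sum_mul]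
  refine sum_bij (fun B hB => B.max' (h1 B hB)) hmem (fun B hB C hC => hinj B hB C hC) hsurj ?_
  intro B hB
  rw [croStar_block P hP B hB _ (max'_mem B (h1 B hB)) (fun y hy => le_max' _ _ hy), pow_add, mul_comm]
  congr 2
  rw [hM, filter_filter, card_filter]
  apply sum_congr rfl
  intro x _
  rw [ind_ite, ind_and, im, il]

noncomputable def FF (n k : ℕ) : ℤ[X] := ∑ P ∈ Finset.univ.filter
          (fun P : Finset (Finset (Fin n)) => IsPartition P ∧ P.card = k),
        (X : Polynomial ℤ) ^ croStar P

lemma FF_rec (n k : ℕ) : FF (n+1) (k+1) = FF n k + (∑ i ∈ range (k+1), X^i) * FF n (k+1) := by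
  classical
  have hun : Finset.univ.filter
      (fun P : Finset (Finset (Fin (n+1))) => IsPartition P ∧ P.card = k+1) =
    ((Finset.univ.filter (fun P : Finset (Finset (Fin n)) => IsPartition P ∧ P.card = k)).image
      (fun P => ext1 P ∅)) ∪
    (((Finset.univ.filter (fun P : Finset (Finset (Fin n)) => IsPartition P ∧ P.card = k+1)).sigma
      (fun P => P)).image (fun p => ext1 p.1 p.2)) := by
    ext Q
    simp only [mem_filter, mem_univ, true_and, mem_union, mem_image, mem_sigma, Sigma.exists]
    constructor
    · rintro ⟨hQ, hc⟩
      obtain ⟨P, B, hP, hB, rfl⟩ := ext1_surj Q hQ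
      rw [card_ext1] at hc
      rcases hB with hB | rfl
      · right
        refine ⟨P, B, ⟨⟨hP, ?_⟩, hB⟩, rfl⟩
        rw [card_erase_of_mem hB] at hc
        have := card_pos.2 ⟨B, hB⟩
        omega
      · left
        refine ⟨P, ⟨hP, ?_⟩, rfl⟩
        rw [erase_eq_of_notMem (fun h => by simpa using hP.1 _ h)] at hc
        omega
    · rintro (⟨P, ⟨hP, hc⟩, rfl⟩ | ⟨P, B, ⟨⟨hP, hc⟩, hB⟩, rfl⟩)
      · refine ⟨part_ext1 P ∅ hP (Or.inr rfl), ?_⟩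
        rw [card_ext1, erase_eq_of_notMem (fun h => by simpa using hP.1 _ h), hc]
      · refine ⟨part_ext1 P B hP (Or.inl hB), ?_⟩
        rw [card_ext1, card_erase_of_mem hB, hc]; omega
  unfold FF
  rw [hun, sum_union, sum_image, sum_image, sum_sigma]
  · congr 1
    · apply sum_congr rfl
      intro P hP
      simp only [mem_filter, mem_univ, true_and] at hP
      rw [croStar_empty P hP.1]
    · rw [mul_sum]
      apply sum_congr rfl
      intro P hP
      simp only [mem_filter, mem_univ, true_and] at hP
      rw [sum_block P hP.1, hP.2]
  · rintro ⟨P, B⟩ h1 ⟨P', B'⟩ h2 h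
    simp only [coe_sigma, Set.mem_sigma_iff, mem_coe, mem_filter, mem_univ, true_and] at h1 h2
    obtain ⟨rfl, rfl⟩ := ext1_inj P P' B B' h1.1.1 h2.1.1 (Or.inl h1.2) (Or.inl h2.2) h
    rfl
  · rintro P h1 P' h2 h
    simp only [mem_coe, mem_filter, mem_univ, true_and] at h1 h2
    exact (ext1_inj P P' ∅ ∅ h1.1 h2.1 (Or.inr rfl) (Or.inr rfl) h).1
  · rw [disjoint_left]
    intro Q h1 h2
    simp only [mem_filter, mem_univ, true_and, mem_image, mem_sigma, Sigma.exists] at h1 h2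
    obtain ⟨P, ⟨hP, hc⟩, rfl⟩ := h1
    obtain ⟨P', B', ⟨⟨hP', hc'⟩, hB'⟩, h⟩ := h2
    have := (ext1_inj P' P B' ∅ hP' hP (Or.inl hB') (Or.inr rfl) h).2
    subst this
    simpa using hP'.1 _ hB'

lemma FF_eq (n : ℕ) : ∀ k, FF n k = qS n k := by
  induction n with
  | zero =>
    have h : ∀ P : Finset (Finset (Fin 0)), IsPartition P ↔ P = ∅ := by
      intro P
      constructor
      · intro h
        rw [eq_empty_iff_forall_notMem]
        intro B hB
        obtain ⟨x, _⟩ := h.1 B hB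
        exact x.elim0
      · rintro rfl
        exact ⟨by simp, fun x => x.elim0⟩
    intro k
    cases k with
    | zero =>
      have : Finset.univ.filter (fun P : Finset (Finset (Fin 0)) => IsPartition P ∧ P.card = 0) = {∅} := by
        ext P; simp only [h, mem_filter, mem_univ, true_and, mem_singleton, card_eq_zero, and_self]
      rw [FF, this, sum_singleton, croStar_eq]
      simp [qS]
    | succ k =>
      rw [FF, sum_eq_zero, qS]
      intro P hP
      simp only [h, mem_filter, mem_univ, true_and] at hP
      rw [hP.1] at hP
      simp at hP
  | succ n ih =>
    intro k
    cases k with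
    | zero =>
      rw [FF, sum_eq_zero, qS]
      intro P hP
      simp only [mem_filter, mem_univ, true_and, card_eq_zero] at hP
      obtain ⟨hP, rfl⟩ := hP
      have := hP.2 0
      simp at this
    | succ k => rw [FF_rec, qS, ih, ih]

end comb

open Polynomial in
/-- Formula for the modified-crossing generating function of set partitions of
`{1,…,n}` with `k` blocks. -/
theorem stmt2 (n k : ℕ) (hk : k ≤ n) :
    (1 - X) ^ (n - k) *
      ∑ P ∈ Finset.univ.filter
          (fun P : Finset (Finset (Fin n)) => IsPartition P ∧ P.card = k),
        (X : Polynomial ℤ) ^ croStar P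
    = ∑ j ∈ Finset.range (n-k+1),
        (-1 : Polynomial ℤ) ^ j * ((ch n ((k : ℤ) + j) : ℤ) : Polynomial ℤ) *
          qbinom (X : Polynomial ℤ) (k+j) j := by
  rw [← carlitz' n k hk, ← FF_eq, FF]
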